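/- Assume the consistency hypotheses (smooth data, Lipschitz dependence of d and B on s, thrice continuously differentiable bounded solution u) and the mesh coupling k = r·h² = λ·h with λ + 2r ≤ 1. If moreover ‖U⁰ − u⁰‖ = O(h) as h → 0 (where U⁰ᵢ = u₀(xᵢ)), then the discretization is convergent: there exists h₀ > 0 such that for all h ≤ h₀ the discrete equation Φ_h(U_h) = 0 has a solution U_h ∈ X_h, and ‖u_h − U_h‖_{X_h} → 0 as h → 0. -/

import Mathlib

open scoped BigOperators

noncomputable section

/-- Composite quadrature rule `Q_h`. -/
def Qh (h : ℝ) (M' : ℕ) (V : ℕ → ℝ) : ℝ :=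
  (4*h/3) * (2*V 1 - V 2 + 2*V 3)
    + (h/3) * ∑ i ∈ Finset.Icc 2 M', (V (2*i) + 4*V (2*i+1) + V (2*i+2))
    + (4*h/3) * (2*V (2*M'+3) - V (2*M'+4) + 2*V (2*M'+5))

/-- `‖V‖² = Σ_{i=1}^{M-1} h |V_i|²`. -/
def normSq (h : ℝ) (M : ℕ) (V : ℕ → ℝ) : ℝ :=
  ∑ i ∈ Finset.Icc 1 (M-1), h * (V i)^2

/-- `‖Z‖_*² = Σ_{n=0}^{N} k |Z^n|²`. -/
def starSq (k : ℝ) (N : ℕ) (Z : ℕ → ℝ) : ℝ :=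
  ∑ n ∈ Finset.range (N+1), k * (Z n)^2

/-- The norm on `X_h`. -/
def XNorm (h k : ℝ) (M N : ℕ) (V0 : ℕ → ℝ) (V : ℕ → ℕ → ℝ) (VM : ℕ → ℝ) : ℝ :=
  h * (Real.sqrt (starSq k N V0) + Real.sqrt (starSq k N VM))
    + Finset.sup' (Finset.range (N+1)) ⟨0, Finset.mem_range.mpr (Nat.succ_pos N)⟩
        (fun n => Real.sqrt (normSq h M (V n)))

/-- The square of the norm on `Y_h`. -/
def YNormSq (h k : ℝ) (M N : ℕ) (P0 : ℕ → ℝ) (P : ℕ → ℕ → ℝ) (PM : ℕ → ℝ) : ℝ :=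
  starSq k N P0 + normSq h M (P 0) + h * starSq k N PM
    + ∑ n ∈ Finset.Icc 1 N, k * normSq h M (P n)

/-- Extension of an interior vector by the boundary entries. -/
def extV (M : ℕ) (V0 : ℕ → ℝ) (V : ℕ → ℕ → ℝ) (VM : ℕ → ℝ) (n i : ℕ) : ℝ :=
  if i = 0 then V0 n else if i = M then VM n else V n i

/-- Boundary component `P_0^n` of `Φ_h`. -/
def phiP0 (h : ℝ) (M' : ℕ) (B : ℝ → ℝ → ℝ) (ψ2 : ℝ → ℝ)
    (V0 : ℕ → ℝ) (V : ℕ → ℕ → ℝ) (n : ℕ) : ℝ :=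
  (1 + 1/h) * V0 n - (1/h) * V n 1
    - Qh h M' (fun i => B ((i:ℝ)*h) (Qh h M' (fun j => ψ2 ((j:ℝ)*h) * V n j)) * V n i)

/-- Boundary component `P_M^n` of `Φ_h`. -/
def phiPM (h : ℝ) (VM : ℕ → ℝ) (n : ℕ) : ℝ := VM n / h

/-- Interior component `P_i^n` (for `1 ≤ n ≤ N`) of `Φ_h`. -/
def phiPi (h k : ℝ) (M' : ℕ) (d : ℝ → ℝ → ℝ) (ψ1 : ℝ → ℝ)
    (V0 : ℕ → ℝ) (V : ℕ → ℕ → ℝ) (VM : ℕ → ℝ) (n i : ℕ) : ℝ :=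
  (V n i - V (n-1) i)/k
    + (extV (2*(M'+3)) V0 V VM (n-1) i - extV (2*(M'+3)) V0 V VM (n-1) (i-1))/h
    + d ((i:ℝ)*h) (Qh h M' (fun j => ψ1 ((j:ℝ)*h) * V (n-1) j)) * V (n-1) i
    - (extV (2*(M'+3)) V0 V VM (n-1) (i+1) + extV (2*(M'+3)) V0 V VM (n-1) (i-1)
        - 2 * V (n-1) i)/h^2

/-- Interior component `P_i^n` of `Φ_h`, for all `0 ≤ n ≤ N`. -/
def phiP (h k : ℝ) (M' : ℕ) (d : ℝ → ℝ → ℝ) (ψ1 u0 : ℝ → ℝ)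
    (V0 : ℕ → ℝ) (V : ℕ → ℕ → ℝ) (VM : ℕ → ℝ) (n i : ℕ) : ℝ :=
  if n = 0 then V 0 i - u0 ((i:ℝ)*h) else phiPi h k M' d ψ1 V0 V VM n i

/-- `Φ_h(U_h) = 0`: the numerical scheme for the homogeneous Dirichlet condition at `a†`. -/
def Solves (adag T : ℝ) (d B : ℝ → ℝ → ℝ) (ψ1 ψ2 u0 : ℝ → ℝ) (M' N : ℕ)
    (U0 : ℕ → ℝ) (U : ℕ → ℕ → ℝ) (UM : ℕ → ℝ) : Prop :=
  let M := 2*(M'+3); let h := adag / (M : ℝ); let k := T / (N : ℝ);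
  (∀ n ≤ N, phiP0 h M' B ψ2 U0 U n = 0) ∧
  (∀ n ≤ N, phiPM h UM n = 0) ∧
  (∀ n ≤ N, ∀ i, 1 ≤ i → i ≤ M-1 → phiP h k M' d ψ1 u0 U0 U UM n i = 0)

lemma Qh_sub (h : ℝ) (M' : ℕ) (V W : ℕ → ℝ) :
    Qh h M' V - Qh h M' W = Qh h M' (fun i => V i - W i) := by
  have : ∑ i ∈ Finset.Icc 2 M', ((V (2*i) - W (2*i)) + 4*(V (2*i+1) - W (2*i+1))
        + (V (2*i+2) - W (2*i+2)))
      = ∑ i ∈ Finset.Icc 2 M', (V (2*i) + 4*V (2*i+1) + V (2*i+2))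
        - ∑ i ∈ Finset.Icc 2 M', (W (2*i) + 4*W (2*i+1) + W (2*i+2)) := by
    rw [← Finset.sum_sub_distrib]
    exact Finset.sum_congr rfl fun i _ => by ring
  simp only [Qh, this]
  ring

lemma abs_Qh_le {h S : ℝ} (hh : 0 ≤ h) (hS : 0 ≤ S) {M' : ℕ} {V : ℕ → ℝ}
    (hV : ∀ i, 1 ≤ i → i ≤ 2*M'+5 → |V i| ≤ S) :
    |Qh h M' V| ≤ 3 * (2*((M':ℝ)+3)*h) * S := by
  have hsum : |∑ i ∈ Finset.Icc 2 M', (V (2*i) + 4*V (2*i+1) + V (2*i+2))| ≤ M' * (6*S) := by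
    calc _ ≤ ∑ i ∈ Finset.Icc 2 M', |V (2*i) + 4*V (2*i+1) + V (2*i+2)| :=
          Finset.abs_sum_le_sum_abs _ _
      _ ≤ ∑ i ∈ Finset.Icc 2 M', 6*S := by
          refine Finset.sum_le_sum fun i hi => ?_
          rw [Finset.mem_Icc] at hi
          have h1 := abs_le.1 (hV (2*i) (by lia) (by lia))
          have h2 := abs_le.1 (hV (2*i+1) (by lia) (by lia))
          have h3 := abs_le.1 (hV (2*i+2) (by lia) (by lia))
          rw [abs_le]
          constructor <;> linarith
      _ ≤ M' * (6*S) := by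
          rw [Finset.sum_const, nsmul_eq_mul]
          gcongr
          simp
  obtain ⟨s1, s2⟩ := abs_le.1 hsum
  obtain ⟨a1, a2⟩ := abs_le.1 (hV 1 (by lia) (by lia))
  obtain ⟨b1, b2⟩ := abs_le.1 (hV 2 (by lia) (by lia))
  obtain ⟨c1, c2⟩ := abs_le.1 (hV 3 (by lia) (by lia))
  obtain ⟨d1, d2⟩ := abs_le.1 (hV (2*M'+3) (by lia) (by lia))
  obtain ⟨e1, e2⟩ := abs_le.1 (hV (2*M'+4) (by lia) (by lia))
  obtain ⟨f1, f2⟩ := abs_le.1 (hV (2*M'+5) (by lia) (by lia))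
  have key : |(4*(2*V 1 - V 2 + 2*V 3)
      + ∑ i ∈ Finset.Icc 2 M', (V (2*i) + 4*V (2*i+1) + V (2*i+2))
      + 4 * (2*V (2*M'+3) - V (2*M'+4) + 2*V (2*M'+5)))| ≤ 40*S + M'*(6*S) := by
    rw [abs_le]
    constructor <;> linarith
  have hM : (0:ℝ) ≤ M' := Nat.cast_nonneg _
  calc |Qh h M' V| = h/3 * |(4*(2*V 1 - V 2 + 2*V 3)
      + ∑ i ∈ Finset.Icc 2 M', (V (2*i) + 4*V (2*i+1) + V (2*i+2))
      + 4 * (2*V (2*M'+3) - V (2*M'+4) + 2*V (2*M'+5)))| := by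
        rw [← abs_of_nonneg (show (0:ℝ) ≤ h/3 by positivity), ← abs_mul]
        congr 1
        simp only [Qh]
        ring
    _ ≤ h/3 * (40*S + M'*(6*S)) := by gcongr
    _ ≤ 3 * (2*((M':ℝ)+3)*h) * S := by
        have := mul_nonneg hh hS
        have := mul_nonneg hM this
        nlinarith

lemma abs_integral_sub_const_mul_le {f : ℝ → ℝ} (hf : Continuous f) {a b y K : ℝ} (hab : a ≤ b)
    (hy : y ∈ Set.Icc a b)
    (hK : 0 ≤ K) (hLip : ∀ x ∈ Set.Icc a b, |f x - f y| ≤ K * |x - y|) :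
    |(∫ x in a..b, f x) - (b - a) * f y| ≤ K * (b - a)^2 := by
  have h1 : (∫ x in a..b, f x) - (b - a) * f y = ∫ x in a..b, (f x - f y) := by
    rw [intervalIntegral.integral_sub (hf.intervalIntegrable _ _) (by simp)]
    simp
  rw [h1, ← Real.norm_eq_abs]
  refine (intervalIntegral.norm_integral_le_of_norm_le_const (C := K * (b - a)) ?_).trans ?_
  · intro x hx
    rw [Set.uIoc_of_le hab] at hx
    refine (hLip x ⟨hx.1.le, hx.2⟩).trans ?_
    gcongr
    rw [abs_le]
    constructor <;> linarith [hx.1, hx.2, hy.1, hy.2]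
  · rw [abs_of_nonneg (by linarith)]
    exact le_of_eq (by ring)

lemma abs_Qh_sub_integral_le {f : ℝ → ℝ} (hf : Continuous f) {h K : ℝ} (hh : 0 ≤ h) (hK : 0 ≤ K)
    {M' : ℕ} (hM' : 0 < M')
    (hLip : ∀ x ∈ Set.Icc 0 (2*((M':ℝ)+3)*h), ∀ y ∈ Set.Icc 0 (2*((M':ℝ)+3)*h),
      |f x - f y| ≤ K * |x - y|) :
    |Qh h M' (fun i => f ((i:ℝ)*h)) - ∫ x in (0:ℝ)..(2*((M':ℝ)+3)*h), f x|
      ≤ 8 * (2*((M':ℝ)+3)*h) * K * h := by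
  have hmem : ∀ z : ℝ, 0 ≤ z → z ≤ 2*((M':ℝ)+3) → z*h ∈ Set.Icc 0 (2*((M':ℝ)+3)*h) :=
    fun z h0 h1 => ⟨by positivity, by gcongr⟩
  have hM : (1:ℝ) ≤ M' := by exact_mod_cast hM'
  have step : ∀ z : ℝ, 1 ≤ z → z ≤ 2*((M':ℝ)+3) - 1 →
      |f ((z-1)*h) - f (z*h)| ≤ K*h ∧ |f ((z+1)*h) - f (z*h)| ≤ K*h := by
    intro z h0 h1
    constructor
    · refine (hLip _ (hmem _ (by linarith) (by linarith)) _
        (hmem _ (by linarith) (by linarith))).trans (le_of_eq ?_)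
      rw [show (z-1)*h - z*h = -h by ring, abs_neg, abs_of_nonneg hh]
    · refine (hLip _ (hmem _ (by linarith) (by linarith)) _
        (hmem _ (by linarith) (by linarith))).trans (le_of_eq ?_)
      rw [show (z+1)*h - z*h = h by ring, abs_of_nonneg hh]
  have panel : ∀ y w : ℝ, 0 ≤ w → 0 ≤ y - w → y + w ≤ 2*((M':ℝ)+3) →
      |(∫ x in ((y-w)*h)..((y+w)*h), f x) - (2*w*h) * f (y*h)| ≤ K*(2*w*h)^2 := by
    intro y w hw h0 h1
    have := abs_integral_sub_const_mul_le hf (a := (y-w)*h) (b := (y+w)*h) (y := y*h) (K := K)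
      (by gcongr; linarith) ⟨by gcongr; linarith, by gcongr; linarith⟩ hK
      (fun x hx => hLip x ⟨le_trans (by positivity) hx.1, hx.2.trans (by gcongr)⟩ _
        (hmem _ (by linarith) (by linarith)))
    rwa [show (y+w)*h - (y-w)*h = 2*w*h by ring] at this
  have ends : ∀ z : ℝ, 2 ≤ z → z ≤ 2*((M':ℝ)+3) - 2 →
      |(4*h/3) * (2*f ((z-1)*h) - f (z*h) + 2*f ((z+1)*h))
        - ∫ x in ((z-2)*h)..((z+2)*h), f x| ≤ 22*(K*h^2) := by
    intro z h0 h1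
    obtain ⟨p1, p2⟩ := step z (by linarith) (by linarith)
    have p3 := panel z 2 (by norm_num) (by linarith) (by linarith)
    rw [abs_le] at p1 p2 p3 ⊢
    have q1 := mul_le_mul_of_nonneg_left p1.1 hh
    have q2 := mul_le_mul_of_nonneg_left p1.2 hh
    have q3 := mul_le_mul_of_nonneg_left p2.1 hh
    have q4 := mul_le_mul_of_nonneg_left p2.2 hh
    have : 0 ≤ K*h^2 := by positivity
    constructor <;> nlinarith
  have mid : ∀ m : ℕ, 1 ≤ m → m ≤ M' →
      |(h/3) * ∑ i ∈ Finset.Icc 2 m, (f (((2*i:ℕ):ℝ)*h) + 4*f (((2*i+1:ℕ):ℝ)*h)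
          + f (((2*i+2:ℕ):ℝ)*h)) - ∫ x in (4*h)..((2*(m:ℝ)+2)*h), f x| ≤ m*(5*(K*h^2)) := by
    intro m hm
    induction m, hm using Nat.le_induction with
    | base =>
      intro _
      norm_num
      positivity
    | succ m hm ih =>
      intro hm2
      have ih := ih (by lia)
      have hmc : (m:ℝ) + 1 ≤ M' := by exact_mod_cast hm2
      have hm1 : (1:ℝ) ≤ m := by exact_mod_cast hm
      rw [← Finset.insert_Icc_right_eq_Icc_add_one (by lia), Finset.sum_insert (by simp),
        ← intervalIntegral.integral_add_adjacent_intervals (b := (2*(m:ℝ)+2)*h)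
          (hf.intervalIntegrable _ _) (hf.intervalIntegrable _ _)]
      obtain ⟨p1, p2⟩ := step (2*m+3) (by linarith) (by linarith)
      have p3 := panel (2*m+3) 1 (by norm_num) (by linarith) (by linarith)
      push_cast at ih ⊢
      rw [show 2*(m:ℝ)+3-1 = 2*m+2 by ring] at p1 p3
      rw [show 2*(m:ℝ)+3+1 = 2*m+4 by ring] at p2 p3
      rw [show 2*((m:ℝ)+1)+1 = 2*m+3 by ring, show 2*((m:ℝ)+1)+2 = 2*m+4 by ring,
        show 2*((m:ℝ)+1) = 2*m+2 by ring]
      rw [abs_le] at p1 p2 p3 ih ⊢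
      have q1 := mul_le_mul_of_nonneg_left p1.1 hh
      have q2 := mul_le_mul_of_nonneg_left p1.2 hh
      have q3 := mul_le_mul_of_nonneg_left p2.1 hh
      have q4 := mul_le_mul_of_nonneg_left p2.2 hh
      have : 0 ≤ K*h^2 := by positivity
      constructor <;> nlinarith
  have e1 := ends 2 le_rfl (by linarith)
  have e2 := ends (2*M'+4) (by linarith) (by linarith)
  have e3 := mid M' hM' le_rfl
  rw [← intervalIntegral.integral_add_adjacent_intervals (b := (2*(M':ℝ)+2)*h)
      (hf.intervalIntegrable _ _) (hf.intervalIntegrable _ _),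
    ← intervalIntegral.integral_add_adjacent_intervals (a := 0) (b := 4*h)
      (hf.intervalIntegrable _ _) (hf.intervalIntegrable _ _)]
  simp only [Qh]
  norm_num at e1
  rw [show 2*(M':ℝ)+4-1 = 2*M'+3 by ring, show 2*(M':ℝ)+4+1 = 2*M'+5 by ring,
    show 2*(M':ℝ)+4-2 = 2*M'+2 by ring, show 2*(M':ℝ)+4+2 = 2*(M'+3) by ring] at e2
  push_cast at e3 ⊢
  rw [one_mul]
  rw [abs_le] at e1 e2 e3 ⊢
  have : 0 ≤ K*h^2 := by positivity
  have := mul_nonneg (zero_le_one.trans hM) this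
  constructor <;> nlinarith

set_option maxHeartbeats 1000000 in
/-- Weighted discrete maximum principle: the barrier `(1 + c h)^(-i)` absorbs the growth created by
the Robin boundary condition. -/
lemma abs_error_le {a T h k r lam C₂ C₃ η : ℝ} {M N : ℕ} (hM : 2 ≤ M) (hMh : (M:ℝ) * h = a)
    (hNk : (N:ℝ) * k = T) (hh : 0 < h) (hk : 0 < k) (hr : 0 < r) (hlam : 0 < lam)
    (hkr : k = r * h^2) (hkl : k = lam * h) (hstab : lam + 2*r ≤ 1)
    (hC₂ : 0 ≤ C₂) (hC₃ : 0 ≤ C₃) (hη : 0 ≤ η) {c D : ℝ} (hc : c = 2*C₃ + 2)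
    (hch : c * h ≤ 1) (hD : D = c + c^2 + Real.exp (c*a) * (C₂ + 1))
    (hsmall : η * Real.exp (D*T) ≤ 1)
    (e γ : ℕ → ℕ → ℝ) (β : ℕ → ℝ)
    (hbd : ∀ n ≤ N, (1 + 1/h) * e n 0 = e n 1 / h + β n)
    (hint : ∀ n < N, ∀ i, 1 ≤ i → i < M →
      e (n+1) i = (1 - lam - 2*r) * e n i + (lam + r) * e n (i-1) + r * e n (i+1) + k * γ n i)
    (hβ : ∀ n ≤ N, ∀ S ≤ 1, (∀ i, 1 ≤ i → i < M → |e n i| ≤ S) → |β n| ≤ C₃ * S + η)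
    (hγ : ∀ n < N, ∀ S ≤ 1, (∀ i, 1 ≤ i → i < M → |e n i| ≤ S) →
      ∀ i, 1 ≤ i → i < M → |γ n i| ≤ C₂ * S + η)
    (hMz : ∀ n ≤ N, e n M = 0) (hinit : ∀ i, 1 ≤ i → i < M → e 0 i = 0) :
    ∀ n ≤ N, ∀ i ≤ M, |e n i| ≤ η * Real.exp (D*T) := by
  have hc0 : 0 < c := by linarith
  have hD0 : 0 ≤ D := by rw [hD]; positivity
  set p : ℝ := 1 + c*h with hp
  have hp1 : 1 ≤ p := by rw [hp]; nlinarith [mul_pos hc0 hh]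
  have hp0 : 0 < p := by linarith
  set q : ℝ := p⁻¹ with hq
  have hq0 : 0 < q := inv_pos.2 hp0
  have hq1 : q ≤ 1 := inv_le_one_of_one_le₀ hp1
  have hpq : q * p = 1 := inv_mul_cancel₀ hp0.ne'
  have hqh : q * c * h = 1 - q := by rw [hp] at hpq; linarith
  have hqhalf : 1/2 ≤ q := by nlinarith
  have hqpow : ∀ i ≤ M, 1 ≤ Real.exp (c*a) * q^i := by
    intro i hi
    have h1 : p^M ≤ Real.exp (c*a) := by
      rw [← hMh, show c * ((M:ℝ) * h) = (M:ℝ) * (c*h) by ring, Real.exp_nat_mul]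
      gcongr
      rw [hp, add_comm]
      exact Real.add_one_le_exp _
    have h2 : p^i ≤ Real.exp (c*a) := (pow_le_pow_right₀ hp1 hi).trans h1
    calc (1:ℝ) = p^i * q^i := by rw [← mul_pow, mul_comm, hpq, one_pow]
      _ ≤ _ := by gcongr
  set A : ℕ → ℝ := fun n => η * (1 + D*k)^n with hA
  have hA0 : ∀ n, 0 ≤ A n := fun n => by simp only [hA]; positivity
  have hAη : ∀ n, η ≤ A n := fun n =>
    le_mul_of_one_le_right hη (one_le_pow₀ (by nlinarith [mul_nonneg hD0 hk.le]))
  have hAexp : ∀ n ≤ N, A n ≤ η * Real.exp (D*T) := by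
    intro n hn
    simp only [hA]
    gcongr
    calc (1 + D*k)^n ≤ (1 + D*k)^N :=
          pow_le_pow_right₀ (by nlinarith [mul_nonneg hD0 hk.le]) hn
      _ ≤ Real.exp (D*k)^N := by
          gcongr
          rw [add_comm]
          exact Real.add_one_le_exp _
      _ = Real.exp (D*T) := by rw [← Real.exp_nat_mul, ← hNk]; congr 1; ring
  have hqle : ∀ i : ℕ, q^i ≤ 1 := fun i => pow_le_one₀ hq0.le hq1
  have boundary : ∀ n ≤ N, (∀ i, 1 ≤ i → i ≤ M → |e n i| ≤ A n * q^i) →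
      ∀ i ≤ M, |e n i| ≤ A n * q^i := by
    intro n hn hi i hiM
    rcases Nat.eq_zero_or_pos i with rfl | hpos
    · have hb := hβ n hn (A n) ((hAexp n hn).trans hsmall) fun j h1 h2 =>
        (hi j h1 h2.le).trans (mul_le_of_le_one_right (hA0 n) (hqle j))
      have h1 := hi 1 le_rfl (by lia)
      have heq := hbd n hn
      have heq' : (h + 1) * e n 0 = e n 1 + h * β n := by
        field_simp at heq
        linarith
      have hle : (h+1) * |e n 0| ≤ (h+1) * A n := by
        calc (h+1) * |e n 0| = |e n 1 + h * β n| := by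
              rw [← heq', abs_mul, abs_of_pos (by linarith : (0:ℝ) < h+1)]
          _ ≤ |e n 1| + h * |β n| := by
              refine (abs_add_le _ _).trans ?_
              rw [abs_mul, abs_of_pos hh]
          _ ≤ A n * q^1 + h * (C₃ * A n + A n) := by
              gcongr
              exact hb.trans (by linarith [hAη n])
          _ ≤ (h+1) * A n := by
              have h3 : q + h * (C₃ + 1) ≤ 1 := by
                have : (1/2 - q) * (c*h) ≤ 0 :=
                  mul_nonpos_of_nonpos_of_nonneg (by linarith) (by positivity)
                rw [hc] at this hqh
                nlinarith
              nlinarith [mul_le_mul_of_nonneg_left h3 (hA0 n), mul_nonneg hh.le (hA0 n)]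
      simpa using le_of_mul_le_mul_left hle (by linarith)
    · exact hi i hpos hiM
  have main : ∀ n, n ≤ N → ∀ i ≤ M, |e n i| ≤ A n * q^i := by
    intro n
    induction n with
    | zero =>
      intro hn
      refine boundary 0 hn fun i h1 h2 => ?_
      have : e 0 i = 0 := by
        rcases h2.lt_or_eq with h | rfl
        · exact hinit i h1 h
        · exact hMz 0 hn
      rw [this, abs_zero]
      exact mul_nonneg (hA0 0) (pow_nonneg hq0.le _)
    | succ n ih =>
      intro hn
      have ih := ih (by lia)
      refine boundary (n+1) hn fun i h1 h2 => ?_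
      rcases h2.lt_or_eq with hlt | rfl
      · have hg := hγ n hn (A n) ((hAexp n (by lia)).trans hsmall) (fun j h1 h2 =>
          (ih j h2.le).trans (mul_le_of_le_one_right (hA0 n) (hqle j))) i h1 hlt
        obtain ⟨j, rfl⟩ : ∃ j, i = j + 1 := ⟨i - 1, by lia⟩
        have g1 := ih (j+1) (by lia)
        have g2 := ih j (by lia)
        have g3 := ih (j+1+1) (by lia)
        rw [hint n hn _ h1 hlt, Nat.add_sub_cancel]
        have hl : 0 ≤ 1 - lam - 2*r := by linarith
        have hrec : q^j = q^(j+1) * p := by rw [pow_succ, mul_assoc, hpq, mul_one]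
        calc |(1 - lam - 2*r) * e n (j+1) + (lam + r) * e n j + r * e n (j+1+1) + k * γ n (j+1)|
            ≤ (1 - lam - 2*r) * |e n (j+1)| + (lam + r) * |e n j| + r * |e n (j+1+1)|
              + k * |γ n (j+1)| := by
              refine (abs_add_le _ _).trans (add_le_add ((abs_add_le _ _).trans (add_le_add
                ((abs_add_le _ _).trans (add_le_add ?_ ?_)) ?_)) ?_) <;>
              rw [abs_mul, abs_of_nonneg (by positivity)]
          _ ≤ (1 - lam - 2*r) * (A n * q^(j+1)) + (lam + r) * (A n * q^j)
              + r * (A n * q^(j+1+1)) + k * (C₂ * A n + A n) := by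
              gcongr
              exact hg.trans (by linarith [hAη n])
          _ = A n * q^(j+1) * ((1 - lam - 2*r) + (lam + r) * p + r * q)
              + k * (C₂ + 1) * A n := by
              rw [hrec, pow_succ q (j+1)]
              ring
          _ ≤ A n * q^(j+1) * (1 + (c + c^2) * k)
              + k * (C₂ + 1) * A n * (Real.exp (c*a) * q^(j+1)) := by
              have hX : 0 ≤ A n * q^(j+1) := mul_nonneg (hA0 n) (pow_nonneg hq0.le _)
              have hY : 0 ≤ k * (C₂ + 1) * A n := mul_nonneg (by positivity) (hA0 n)
              have hZ : (1 - lam - 2*r) + (lam + r) * p + r * q ≤ 1 + (c + c^2) * k := by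
                have e1 : q ≥ 1 - c*h := by nlinarith [mul_pos hc0 hh]
                have e2 : q - 1 = -(q*c*h) := by linarith
                have e3 : (1 - lam - 2*r) + (lam + r) * p + r * q
                    = 1 + c * (lam*h) + r * (c*h) * (1 - q) := by
                  rw [hp]
                  linear_combination r * e2
                have e4 : r * (c*h) * (1-q) ≤ r * (c*h) * (c*h) := by
                  gcongr
                  linarith
                rw [e3, ← hkl]
                have : r * (c*h) * (c*h) = c^2 * k := by rw [hkr]; ring
                linarith
              have := mul_le_mul_of_nonneg_left hZ hX
              have := mul_le_mul_of_nonneg_left (hqpow (j+1) h2) hY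
              linarith
          _ = A (n+1) * q^(j+1) := by
              simp only [hA, hD]
              ring
      · rw [hMz _ hn, abs_zero]
        exact mul_nonneg (hA0 _) (pow_nonneg hq0.le _)
  intro n hn i hi
  exact ((main n hn i hi).trans (mul_le_of_le_one_right (hA0 n) (hqle i))).trans (hAexp n hn)

/-- `w` is bounded by `K` and `K`-Lipschitz on `[0, a]`. -/
def BddLipOn (a K : ℝ) (w : ℝ → ℝ) : Prop :=
  ∀ x ∈ Set.Icc 0 a, |w x| ≤ K ∧ ∀ y ∈ Set.Icc 0 a, |w x - w y| ≤ K * |x - y|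

lemma abs_sub_le_of_hasDerivAt {f f' : ℝ → ℝ} {K x y : ℝ}
    (hf : ∀ s ∈ Set.uIcc x y, HasDerivAt f (f' s) s) (hK : ∀ s ∈ Set.uIcc x y, |f' s| ≤ K) :
    |f y - f x| ≤ K * |y - x| :=
  (convex_uIcc x y).norm_image_sub_le_of_norm_hasDerivWithin_le
    (fun s hs => (hf s hs).hasDerivWithinAt) hK Set.left_mem_uIcc Set.right_mem_uIcc

lemma abs_sub_le_of_mem_uIcc {x h s : ℝ} (hs : s ∈ Set.uIcc x (x+h)) : |s - x| ≤ |h| := by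
  simpa using Set.abs_sub_left_of_mem_uIcc hs

lemma abs_taylor_one_le {f f' f'' : ℝ → ℝ} {K : ℝ} (h1 : ∀ s, HasDerivAt f (f' s) s)
    (h2 : ∀ s, HasDerivAt f' (f'' s) s) (hK : ∀ s, |f'' s| ≤ K) (x h : ℝ) :
    |f (x+h) - f x - h * f' x| ≤ K * |h|^2 := by
  have hK0 : 0 ≤ K := (abs_nonneg _).trans (hK 0)
  have := abs_sub_le_of_hasDerivAt (f := fun s => f s - s * f' x) (f' := fun s => f' s - 1 * f' x)
    (K := K * |h|) (x := x) (y := x+h)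
    (fun s _ => (h1 s).sub ((hasDerivAt_id s).mul_const _)) (fun s hs => by
      rw [one_mul]
      refine (abs_sub_le_of_hasDerivAt (fun s _ => h2 s) (fun s _ => hK s)).trans ?_
      exact mul_le_mul_of_nonneg_left (abs_sub_le_of_mem_uIcc hs) hK0)
  rw [show x + h - x = h by ring] at this
  calc _ = |f (x+h) - (x+h) * f' x - (f x - x * f' x)| := by congr 1; ring
    _ ≤ _ := this.trans (le_of_eq (by ring))

lemma abs_taylor_two_le {f f' f'' f''' : ℝ → ℝ} {K : ℝ} (h1 : ∀ s, HasDerivAt f (f' s) s)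
    (h2 : ∀ s, HasDerivAt f' (f'' s) s) (h3 : ∀ s, HasDerivAt f'' (f''' s) s)
    (hK : ∀ s, |f''' s| ≤ K) (x h : ℝ) :
    |f (x+h) - f x - h * f' x - h^2/2 * f'' x| ≤ K * |h|^3 := by
  have hK0 : 0 ≤ K := (abs_nonneg _).trans (hK 0)
  have := abs_sub_le_of_hasDerivAt
    (f := fun s => f s - s * f' x - (s - x)^2/2 * f'' x)
    (f' := fun s => f' s - f' x - (s - x) * f'' x)
    (K := K * |h|^2) (x := x) (y := x+h)
    (fun s _ => by
      have a1 := (h1 s).sub ((hasDerivAt_id s).mul_const (f' x))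
      have a2 := ((((hasDerivAt_id s).sub_const x).pow 2).div_const 2).mul_const (f'' x)
      refine (a1.sub a2).congr_deriv ?_
      simp) (fun s hs => by
      have := abs_taylor_one_le h2 h3 hK x (s - x)
      rw [show x + (s - x) = s by ring] at this
      refine this.trans ?_
      exact mul_le_mul_of_nonneg_left
        (pow_le_pow_left₀ (abs_nonneg _) (abs_sub_le_of_mem_uIcc hs) 2) hK0)
  rw [show x + h - x = h by ring] at this
  calc _ = |f (x+h) - (x+h) * f' x - h^2/2 * f'' x - (f x - x * f' x - (x - x)^2/2 * f'' x)| := by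
        congr 1; ring
    _ ≤ _ := this.trans (le_of_eq (by ring))

lemma abs_central_difference_le {f f' f'' f''' : ℝ → ℝ} {K : ℝ}
    (h1 : ∀ s, HasDerivAt f (f' s) s)
    (h2 : ∀ s, HasDerivAt f' (f'' s) s) (h3 : ∀ s, HasDerivAt f'' (f''' s) s)
    (hK : ∀ s, |f''' s| ≤ K) (x h : ℝ) :
    |f (x+h) + f (x-h) - 2 * f x - h^2 * f'' x| ≤ 2 * K * |h|^3 := by
  have a := abs_taylor_two_le h1 h2 h3 hK x h
  have b := abs_taylor_two_le h1 h2 h3 hK x (-h)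
  rw [abs_neg, ← sub_eq_add_neg] at b
  rw [abs_le] at a b ⊢
  constructor <;> linarith

/-- `F` is of class `C^(m+1)` in the plane, with derivatives bounded by `K` up to that order. -/
def BddContDiff (m : ℕ) (K : ℝ) (F : ℝ × ℝ → ℝ) : Prop :=
  ContDiff ℝ m F ∧ ∀ j ≤ m, ∀ p, ‖iteratedFDeriv ℝ j F p‖ ≤ K

lemma BddContDiff.fderiv_apply {m : ℕ} {K : ℝ} {F : ℝ × ℝ → ℝ} (hF : BddContDiff (m+1) K F)
    {v : ℝ × ℝ} (hv : ‖v‖ ≤ 1) : BddContDiff m K (fun p => fderiv ℝ F p v) := by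
  have hc : ContDiff ℝ m (fderiv ℝ F) := hF.1.fderiv_right (by norm_cast)
  refine ⟨hc.clm_apply contDiff_const, fun j hj p => ?_⟩
  refine (norm_iteratedFDeriv_clm_apply_const hc.contDiffAt (by exact_mod_cast hj)).trans ?_
  rw [norm_iteratedFDeriv_fderiv]
  exact (mul_le_of_le_one_left (norm_nonneg _) hv).trans (hF.2 (j+1) (by lia) p)

lemma BddContDiff.abs_le {m : ℕ} {K : ℝ} {F : ℝ × ℝ → ℝ} (hF : BddContDiff m K F) (p : ℝ × ℝ) :
    |F p| ≤ K := by
  simpa using hF.2 0 (Nat.zero_le _) p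

lemma hasDerivAt_fst {F : ℝ × ℝ → ℝ} (hF : Differentiable ℝ F) (x t : ℝ) :
    HasDerivAt (fun ξ => F (ξ, t)) (fderiv ℝ F (x, t) (1, 0)) x :=
  (hF (x, t)).hasFDerivAt.comp_hasDerivAt x ((hasDerivAt_id x).prodMk (hasDerivAt_const x t))

lemma hasDerivAt_snd {F : ℝ × ℝ → ℝ} (hF : Differentiable ℝ F) (x t : ℝ) :
    HasDerivAt (fun τ => F (x, τ)) (fderiv ℝ F (x, t) (0, 1)) t :=
  (hF (x, t)).hasFDerivAt.comp_hasDerivAt t ((hasDerivAt_const t x).prodMk (hasDerivAt_id t))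

lemma BddContDiff.differentiable {m : ℕ} {K : ℝ} {F : ℝ × ℝ → ℝ} (hF : BddContDiff (m+1) K F) :
    Differentiable ℝ F :=
  hF.1.differentiable (by simp)

lemma exists_partial_derivatives {u : ℝ → ℝ → ℝ} (hu : ContDiff ℝ 3 (Function.uncurry u))
    (hu_bdd : ∀ m : ℕ, m ≤ 3 → ∃ K : ℝ, ∀ p : ℝ × ℝ,
      ‖iteratedFDeriv ℝ m (Function.uncurry u) p‖ ≤ K) :
    ∃ (K : ℝ) (ux uxx uxxx ut utt : ℝ × ℝ → ℝ),
      (∀ x t, |u x t| ≤ K) ∧ (∀ p, |ux p| ≤ K) ∧ (∀ p, |uxx p| ≤ K) ∧ (∀ p, |uxxx p| ≤ K) ∧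
      (∀ p, |utt p| ≤ K) ∧ Continuous ux ∧ Continuous uxx ∧ Continuous ut ∧
      (∀ x t, HasDerivAt (fun ξ => u ξ t) (ux (x, t)) x) ∧
      (∀ x t, HasDerivAt (fun ξ => ux (ξ, t)) (uxx (x, t)) x) ∧
      (∀ x t, HasDerivAt (fun ξ => uxx (ξ, t)) (uxxx (x, t)) x) ∧
      (∀ x t, HasDerivAt (fun τ => u x τ) (ut (x, t)) t) ∧
      (∀ x t, HasDerivAt (fun τ => ut (x, τ)) (utt (x, t)) t) := by
  choose! K hK using hu_bdd
  have hU : BddContDiff 3 (|K 0| + |K 1| + |K 2| + |K 3|) (Function.uncurry u) := by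
    refine ⟨hu, fun j hj p => (hK j hj p).trans ?_⟩
    have := abs_nonneg (K 0)
    have := abs_nonneg (K 1)
    have := abs_nonneg (K 2)
    have := abs_nonneg (K 3)
    have := le_abs_self (K j)
    interval_cases j <;> linarith
  have n1 : ‖((1:ℝ), (0:ℝ))‖ ≤ 1 := by simp [Prod.norm_def]
  have n2 : ‖((0:ℝ), (1:ℝ))‖ ≤ 1 := by simp [Prod.norm_def]
  have hx := hU.fderiv_apply n1
  have hxx := hx.fderiv_apply n1
  have hxxx := hxx.fderiv_apply n1
  have ht := hU.fderiv_apply n2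
  have htt := ht.fderiv_apply n2
  exact ⟨_, _, _, _, _, _, fun x t => hU.abs_le (x, t), hx.abs_le, hxx.abs_le, hxxx.abs_le,
    htt.abs_le, hx.1.continuous, hxx.1.continuous, ht.1.continuous,
    hasDerivAt_fst hU.differentiable, hasDerivAt_fst hx.differentiable,
    hasDerivAt_fst hxx.differentiable, hasDerivAt_snd hU.differentiable,
    hasDerivAt_snd ht.differentiable⟩

lemma exists_bound_and_lipschitz {g : ℝ → ℝ → ℝ} (hg : ContDiff ℝ (⊤ : ℕ∞) (Function.uncurry g))
    (a S : ℝ) : ∃ K : ℝ, 0 ≤ K ∧ ∀ s, |s| ≤ S → BddLipOn a K fun x => g x s := by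
  have hcomp : IsCompact (Set.Icc (0:ℝ) a ×ˢ Set.Icc (-S) S) := isCompact_Icc.prod isCompact_Icc
  obtain ⟨K₁, hK₁⟩ := hcomp.exists_bound_of_continuousOn hg.continuous.continuousOn
  have hd : Continuous fun p => fderiv ℝ (Function.uncurry g) p (1, 0) :=
    (hg.continuous_fderiv (by simp)).clm_apply continuous_const
  obtain ⟨K₂, hK₂⟩ := hcomp.exists_bound_of_continuousOn hd.continuousOn
  refine ⟨max 0 (max K₁ K₂), le_max_left _ _, fun s hs x hx => ⟨?_, fun y hy => ?_⟩⟩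
  · exact (hK₁ (x, s) ⟨hx, abs_le.1 hs⟩).trans ((le_max_left _ _).trans (le_max_right _ _))
  · refine abs_sub_le_of_hasDerivAt (f := fun ξ => g ξ s)
      (fun z _ => hasDerivAt_fst (hg.differentiable (by simp)) z s) fun z hz => ?_
    exact (hK₂ (z, s) ⟨Set.uIcc_subset_Icc hy hx hz, abs_le.1 hs⟩).trans
      ((le_max_right _ _).trans (le_max_right _ _))

lemma exists_bddLipOn {ψ : ℝ → ℝ} (hψ : ContDiff ℝ (⊤ : ℕ∞) ψ) (a : ℝ) :
    ∃ K : ℝ, 0 ≤ K ∧ BddLipOn a K ψ := by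
  obtain ⟨K, hK, h⟩ := exists_bound_and_lipschitz (g := fun x _ => ψ x)
    (hψ.comp contDiff_fst) a 0
  exact ⟨K, hK, h 0 (by simp)⟩

lemma abs_Qh_mul_sub_integral_le {w v : ℝ → ℝ} (hw : Continuous w) (hv : Continuous v)
    {a h K₁ K₂ : ℝ} (hh : 0 ≤ h) {M' : ℕ} (hM' : 0 < M') (hMh : 2*((M':ℝ)+3)*h = a)
    (hK₁ : 0 ≤ K₁) (hK₂ : 0 ≤ K₂)
    (hwK : BddLipOn a K₁ w)
    (hvK : BddLipOn a K₂ v) :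
    |Qh h M' (fun i => w ((i:ℝ)*h) * v ((i:ℝ)*h)) - ∫ x in (0:ℝ)..a, w x * v x|
      ≤ 16 * a * K₁ * K₂ * h := by
  have := abs_Qh_sub_integral_le (hw.mul hv) hh (K := 2 * K₁ * K₂) (by positivity) hM' (by
    rw [hMh]
    intro x hx y hy
    calc |w x * v x - w y * v y| = |w x * (v x - v y) + (w x - w y) * v y| := by congr 1; ring
      _ ≤ |w x| * |v x - v y| + |w x - w y| * |v y| := by
          rw [← abs_mul, ← abs_mul]; exact abs_add_le _ _
      _ ≤ K₁ * (K₂ * |x - y|) + (K₁ * |x - y|) * K₂ := by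
          gcongr
          exacts [(hwK x hx).1, (hvK x hx).2 y hy, (hwK x hx).2 y hy, (hvK y hy).1]
      _ = _ := by ring)
  rw [hMh] at this
  exact this.trans (le_of_eq (by ring))

lemma abs_nonlocal_mul_sub_le {g : ℝ → ℝ} {L a h Kg Kψ R S : ℝ} (hL : 0 ≤ L)
    (hg : ∀ s s', |g s - g s'| ≤ L * |s - s'|) (hh : 0 ≤ h) {M' : ℕ}
    (hMh : 2*((M':ℝ)+3)*h = a) {ψ V W : ℕ → ℝ} (hKψ : 0 ≤ Kψ)
    (hψ : ∀ i, 1 ≤ i → i ≤ 2*M'+5 → |ψ i| ≤ Kψ)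
    (hgV : |g (Qh h M' fun j => ψ j * V j)| ≤ Kg)
    (hS : 0 ≤ S) (hVW : ∀ i, 1 ≤ i → i ≤ 2*M'+5 → |V i - W i| ≤ S)
    {i : ℕ} (hi : 1 ≤ i) (hi' : i ≤ 2*M'+5) (hW : |W i| ≤ R) :
    |g (Qh h M' fun j => ψ j * V j) * V i - g (Qh h M' fun j => ψ j * W j) * W i|
      ≤ (Kg + 3 * a * L * Kψ * R) * S := by
  have hQ : |(Qh h M' fun j => ψ j * V j) - Qh h M' fun j => ψ j * W j| ≤ 3 * a * (Kψ * S) := by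
    rw [Qh_sub, ← hMh]
    refine abs_Qh_le hh (by positivity) fun j h1 h2 => ?_
    rw [← mul_sub, abs_mul]
    exact mul_le_mul (hψ j h1 h2) (hVW j h1 h2) (abs_nonneg _) hKψ
  set q := Qh h M' fun j => ψ j * V j
  set q' := Qh h M' fun j => ψ j * W j
  have hKg : 0 ≤ Kg := (abs_nonneg _).trans hgV
  have hgL : |g q - g q'| ≤ L * (3 * a * (Kψ * S)) :=
    (hg _ _).trans (mul_le_mul_of_nonneg_left hQ hL)
  calc |g q * V i - g q' * W i| = |g q * (V i - W i) + (g q - g q') * W i| := by congr 1; ring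
    _ ≤ |g q| * |V i - W i| + |g q - g q'| * |W i| := by
        rw [← abs_mul, ← abs_mul]; exact abs_add_le _ _
    _ ≤ Kg * S + (L * (3 * a * (Kψ * S))) * R :=
        add_le_add (mul_le_mul hgV (hVW i hi hi') (abs_nonneg _) hKg)
          (mul_le_mul hgL hW (abs_nonneg _) ((abs_nonneg _).trans hgL))
    _ = _ := by ring

lemma exists_scheme_solution (h k : ℝ) (hh : 0 < h) (hk : 0 < k) (M' : ℕ) (d B : ℝ → ℝ → ℝ)
    (ψ1 ψ2 u0 : ℝ → ℝ) : ∃ (U0 : ℕ → ℝ) (U : ℕ → ℕ → ℝ) (UM : ℕ → ℝ),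
      (∀ n, phiP0 h M' B ψ2 U0 U n = 0) ∧ (∀ n, phiPM h UM n = 0) ∧
      ∀ n i, phiP h k M' d ψ1 u0 U0 U UM n i = 0 := by
  let bd : (ℕ → ℝ) → ℝ := fun V => (V 1 / h
    + Qh h M' (fun i => B ((i:ℝ)*h) (Qh h M' (fun j => ψ2 ((j:ℝ)*h) * V j)) * V i)) / (1 + 1/h)
  let ext : (ℕ → ℝ) → ℕ → ℝ := fun V i => if i = 0 then bd V else if i = 2*(M'+3) then 0 else V i
  let U : ℕ → ℕ → ℝ := fun n => Nat.rec (fun i => u0 ((i:ℝ)*h)) (fun _ V i =>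
    V i - k * ((ext V i - ext V (i-1))/h
      + d ((i:ℝ)*h) (Qh h M' (fun j => ψ1 ((j:ℝ)*h) * V j)) * V i
      - (ext V (i+1) + ext V (i-1) - 2 * V i)/h^2)) n
  have hext : ∀ n i, extV (2*(M'+3)) (fun n => bd (U n)) U (fun _ => 0) n i = ext (U n) i :=
    fun n i => rfl
  refine ⟨fun n => bd (U n), U, fun _ => 0, fun n => ?_, fun n => by simp [phiPM], fun n i => ?_⟩
  · have : (1 + 1/h) ≠ 0 := by positivity
    simp only [phiP0, bd]
    rw [mul_div_cancel₀ _ this]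
    ring
  · cases n with
    | zero => simp [phiP, U]
    | succ n =>
      have hU : U (n+1) i = U n i - k * ((ext (U n) i - ext (U n) (i-1))/h
        + d ((i:ℝ)*h) (Qh h M' (fun j => ψ1 ((j:ℝ)*h) * U n j)) * U n i
        - (ext (U n) (i+1) + ext (U n) (i-1) - 2 * U n i)/h^2) := rfl
      rw [phiP, if_neg (Nat.succ_ne_zero n), phiPi, Nat.add_sub_cancel, hU]
      simp only [hext]
      field_simp
      ring

lemma XNorm_le {h k T a E : ℝ} {M N : ℕ} (hh : 0 ≤ h) (hk : 0 ≤ k) (hNk : N * k = T)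
    (hN : 0 < N) (hMh : M * h = a) (hE : 0 ≤ E) {V0 : ℕ → ℝ} {V : ℕ → ℕ → ℝ} {VM : ℕ → ℝ}
    (h0 : ∀ n ≤ N, |V0 n| ≤ E) (h1 : ∀ n ≤ N, ∀ i, 1 ≤ i → i ≤ M-1 → |V n i| ≤ E)
    (h2 : ∀ n ≤ N, |VM n| ≤ E) :
    XNorm h k M N V0 V VM ≤ (2 * h * Real.sqrt (2*T) + Real.sqrt a) * E := by
  have hstar : ∀ Z : ℕ → ℝ, (∀ n ≤ N, |Z n| ≤ E) →
      Real.sqrt (starSq k N Z) ≤ Real.sqrt (2*T) * E := by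
    intro Z hZ
    rw [← Real.sqrt_sq hE, ← Real.sqrt_mul' _ (sq_nonneg E)]
    refine Real.sqrt_le_sqrt ?_
    calc starSq k N Z ≤ ∑ n ∈ Finset.range (N+1), k * E^2 := by
          refine Finset.sum_le_sum fun n hn => ?_
          refine mul_le_mul_of_nonneg_left ?_ hk
          exact sq_le_sq.2 ((hZ n (by simpa [Nat.lt_succ_iff] using hn)).trans (le_abs_self E))
      _ = (N + 1) * k * E^2 := by simp; ring
      _ ≤ 2*T*E^2 := by
          have : (1:ℝ) ≤ N := by exact_mod_cast hN
          rw [← hNk, ← mul_assoc]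
          gcongr
          linarith
  have hV : ∀ n ≤ N, Real.sqrt (normSq h M (V n)) ≤ Real.sqrt a * E := by
    intro n hn
    rw [← Real.sqrt_sq hE, ← Real.sqrt_mul' _ (sq_nonneg E)]
    refine Real.sqrt_le_sqrt ?_
    calc normSq h M (V n) ≤ ∑ i ∈ Finset.Icc 1 (M-1), h * E^2 := by
          refine Finset.sum_le_sum fun i hi => ?_
          rw [Finset.mem_Icc] at hi
          refine mul_le_mul_of_nonneg_left ?_ hh
          exact sq_le_sq.2 ((h1 n hn i hi.1 hi.2).trans (le_abs_self E))
      _ = ((M-1:ℕ):ℝ) * (h * E^2) := by simp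
      _ ≤ M * (h * E^2) := by
          gcongr
          lia
      _ = a*E^2 := by rw [← hMh]; ring
  have hsup : Finset.sup' (Finset.range (N+1)) ⟨0, Finset.mem_range.mpr (Nat.succ_pos N)⟩
      (fun n => Real.sqrt (normSq h M (V n))) ≤ Real.sqrt a * E :=
    Finset.sup'_le _ _ fun n hn => hV n (by simpa [Nat.lt_succ_iff] using hn)
  have := mul_le_mul_of_nonneg_left (add_le_add (hstar V0 h0) (hstar VM h2)) hh
  rw [XNorm]
  linarith

lemma mesh_mem_Icc {a h : ℝ} (hh : 0 ≤ h) {M' : ℕ} (hMh : 2*((M':ℝ)+3)*h = a) {i : ℕ}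
    (hi : i ≤ 2*(M'+3)) : (i:ℝ)*h ∈ Set.Icc 0 a := by
  refine ⟨by positivity, ?_⟩
  rw [← hMh]
  gcongr
  exact_mod_cast hi

lemma abs_Qh_mul_le {w v : ℝ → ℝ} {a h K₁ K₂ : ℝ} (hh : 0 ≤ h) {M' : ℕ}
    (hMh : 2*((M':ℝ)+3)*h = a) (hK₁ : 0 ≤ K₁) (hK₂ : 0 ≤ K₂)
    (hw : BddLipOn a K₁ w) (hv : BddLipOn a K₂ v) :
    |Qh h M' (fun i => w ((i:ℝ)*h) * v ((i:ℝ)*h))| ≤ 3 * a * K₁ * K₂ := by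
  rw [show 3 * a * K₁ * K₂ = 3 * a * (K₁ * K₂) by ring, ← hMh]
  refine abs_Qh_le hh (by positivity) fun i _ h2 => ?_
  have hx := mesh_mem_Icc hh hMh (i := i) (by lia)
  rw [abs_mul]
  exact mul_le_mul (hw _ hx).1 (hv _ hx).1 (abs_nonneg _) hK₁

lemma abs_integral_mul_le {w v : ℝ → ℝ} {a K₁ K₂ : ℝ} (ha : 0 ≤ a) (hK₁ : 0 ≤ K₁) (hK₂ : 0 ≤ K₂)
    (hw : BddLipOn a K₁ w) (hv : BddLipOn a K₂ v) :
    |∫ x in (0:ℝ)..a, w x * v x| ≤ 3 * a * K₁ * K₂ := by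
  refine (intervalIntegral.norm_integral_le_of_norm_le_const (f := fun x => w x * v x)
    (C := K₁ * K₂) fun x hx => ?_).trans ?_
  · rw [Set.uIoc_of_le ha] at hx
    have hx : x ∈ Set.Icc 0 a := ⟨hx.1.le, hx.2⟩
    rw [norm_mul]
    exact mul_le_mul (hw _ hx).1 (hv _ hx).1 (abs_nonneg _) hK₁
  · rw [sub_zero, abs_of_nonneg ha]
    have : 0 ≤ a * K₁ * K₂ := by positivity
    linarith

lemma abs_boundary_consistency_le {v v' v'' ψ : ℝ → ℝ} {b : ℝ → ℝ → ℝ} {a h L K Kψ Kb : ℝ}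
    (hh : 0 < h) {M' : ℕ} (hM' : 0 < M') (hMh : 2*((M':ℝ)+3)*h = a) (hL : 0 ≤ L) (hK : 0 ≤ K)
    (hKψ : 0 ≤ Kψ) (hKb : 0 ≤ Kb)
    (h1 : ∀ s, HasDerivAt v (v' s) s) (h2 : ∀ s, HasDerivAt v' (v'' s) s) (hK2 : ∀ s, |v'' s| ≤ K)
    (hψc : Continuous ψ) (hψ : BddLipOn a Kψ ψ) (hv : BddLipOn a K v)
    (hbc : ∀ s, Continuous fun x => b x s)
    (hb : ∀ s, |s| ≤ 3 * a * Kψ * K → BddLipOn a Kb fun x => b x s)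
    (hbL : ∀ x s s', |b x s - b x s'| ≤ L * |s - s'|)
    (hRobin : v 0 - v' 0 = ∫ x in (0:ℝ)..a, b x (∫ x in (0:ℝ)..a, ψ x * v x) * v x) :
    |(1 + 1/h) * v 0 - (1/h) * v h
        - Qh h M' (fun i => b ((i:ℝ)*h) (Qh h M' (fun j => ψ ((j:ℝ)*h) * v ((j:ℝ)*h)))
          * v ((i:ℝ)*h))|
      ≤ (K + 16 * a * Kb * K + 3 * a * (L * (16 * a * Kψ * K) * K)) * h := by
  have ha : 0 ≤ a := hMh ▸ by positivity
  have hvc : Continuous v := continuous_iff_continuousAt.2 fun s => (h1 s).continuousAt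
  have hs := abs_integral_mul_le ha hKψ hK hψ hv
  have hqs := abs_Qh_mul_sub_integral_le hψc hvc hh.le hM' hMh hKψ hK hψ hv
  set s := ∫ x in (0:ℝ)..a, ψ x * v x
  set q := Qh h M' (fun j => ψ ((j:ℝ)*h) * v ((j:ℝ)*h))
  have hB := abs_Qh_mul_sub_integral_le (hbc s) hvc hh.le hM' hMh hKb hK (hb s hs) hv
  have hT := abs_taylor_one_le h1 h2 hK2 0 h
  rw [zero_add, abs_of_pos hh] at hT
  have hT' : |(v h - v 0)/h - v' 0| ≤ K * h := by
    rw [show (v h - v 0)/h - v' 0 = (v h - v 0 - h * v' 0)/h by field_simp, abs_div,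
      abs_of_pos hh, div_le_iff₀ hh]
    linarith
  have hQ : |Qh h M' (fun i => b ((i:ℝ)*h) q * v ((i:ℝ)*h))
      - Qh h M' (fun i => b ((i:ℝ)*h) s * v ((i:ℝ)*h))|
      ≤ 3 * a * ((L * (16 * a * Kψ * K * h)) * K) := by
    rw [Qh_sub]
    nth_rw 1 [← hMh]
    refine abs_Qh_le hh.le (by positivity) fun i _ hi => ?_
    rw [← sub_mul, abs_mul]
    refine mul_le_mul ((hbL _ _ _).trans ?_) (hv _ (mesh_mem_Icc hh.le hMh (by lia))).1
      (abs_nonneg _) (by positivity)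
    gcongr
  have heq : (1 + 1/h) * v 0 - (1/h) * v h = v 0 - (v h - v 0)/h := by ring
  rw [heq]
  rw [abs_le] at hB hT' hQ ⊢
  constructor <;> linarith

lemma abs_interior_consistency_le {v v' v'' v''' w w' w'' ψ : ℝ → ℝ} {g : ℝ → ℝ}
    {a h k x t L K Kψ : ℝ}
    (hh : 0 < h) (hk : 0 < k) (hkh : k ≤ h) {M' : ℕ} (hM' : 0 < M')
    (hMh : 2*((M':ℝ)+3)*h = a) (hL : 0 ≤ L) (hK : 0 ≤ K) (hKψ : 0 ≤ Kψ)
    (h1 : ∀ s, HasDerivAt v (v' s) s) (h2 : ∀ s, HasDerivAt v' (v'' s) s)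
    (h3 : ∀ s, HasDerivAt v'' (v''' s) s)
    (hK2 : ∀ s, |v'' s| ≤ K) (hK3 : ∀ s, |v''' s| ≤ K)
    (k1 : ∀ s, HasDerivAt w (w' s) s) (k2 : ∀ s, HasDerivAt w' (w'' s) s)
    (hKw : ∀ s, |w'' s| ≤ K) (hwv : w t = v x) (hvx : |v x| ≤ K)
    (hψc : Continuous ψ) (hψ : BddLipOn a Kψ ψ) (hv : BddLipOn a K v)
    (hgL : ∀ s s', |g s - g s'| ≤ L * |s - s'|)
    (hPDE : w' t + v' x + g (∫ x in (0:ℝ)..a, ψ x * v x) * v x = v'' x) :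
    |(w (t+k) - v x)/k + (v x - v (x-h))/h
        + g (Qh h M' (fun j => ψ ((j:ℝ)*h) * v ((j:ℝ)*h))) * v x
        - (v (x+h) + v (x-h) - 2 * v x)/h^2|
      ≤ (4 * K + L * (16 * a * Kψ * K) * K) * h := by
  have hvc : Continuous v := continuous_iff_continuousAt.2 fun s => (h1 s).continuousAt
  have hqs := abs_Qh_mul_sub_integral_le hψc hvc hh.le hM' hMh hKψ hK hψ hv
  set s := ∫ x in (0:ℝ)..a, ψ x * v x
  set q := Qh h M' (fun j => ψ ((j:ℝ)*h) * v ((j:ℝ)*h))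
  have t1 : |(w (t+k) - v x)/k - w' t| ≤ K * h := by
    have := abs_taylor_one_le k1 k2 hKw t k
    rw [abs_of_pos hk, hwv] at this
    rw [show (w (t+k) - v x)/k - w' t = (w (t+k) - v x - k * w' t)/k by field_simp, abs_div,
      abs_of_pos hk, div_le_iff₀ hk]
    refine this.trans ?_
    rw [mul_assoc, sq]
    gcongr
  have t2 : |(v x - v (x-h))/h - v' x| ≤ K * h := by
    have := abs_taylor_one_le h1 h2 hK2 x (-h)
    rw [abs_neg, abs_of_pos hh, ← sub_eq_add_neg] at this
    rw [show (v x - v (x-h))/h - v' x = -(v (x-h) - v x - (-h) * v' x)/h by field_simp; ring,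
      abs_div, abs_neg, abs_of_pos hh, div_le_iff₀ hh]
    linarith
  have t3 : |(v (x+h) + v (x-h) - 2 * v x)/h^2 - v'' x| ≤ 2 * K * h := by
    have := abs_central_difference_le h1 h2 h3 hK3 x h
    rw [abs_of_pos hh] at this
    rw [show (v (x+h) + v (x-h) - 2 * v x)/h^2 - v'' x
        = (v (x+h) + v (x-h) - 2 * v x - h^2 * v'' x)/h^2 by field_simp, abs_div,
      abs_of_pos (by positivity : 0 < h^2), div_le_iff₀ (by positivity)]
    linarith
  have t4 : |g q * v x - g s * v x| ≤ L * (16 * a * Kψ * K * h) * K := by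
    rw [← sub_mul, abs_mul]
    have hgq : |g q - g s| ≤ L * (16 * a * Kψ * K * h) :=
      (hgL q s).trans (mul_le_mul_of_nonneg_left hqs hL)
    exact mul_le_mul hgq hvx (abs_nonneg _) ((abs_nonneg _).trans hgq)
  rw [abs_le] at t1 t2 t3 t4 ⊢
  constructor <;> linarith

lemma eqOn_Icc_of_eqOn_Ioc {f g : ℝ → ℝ} (hf : Continuous f) (hg : Continuous g) {T : ℝ}
    (hT : 0 < T) (h : ∀ t ∈ Set.Ioc 0 T, f t = g t) : ∀ t ∈ Set.Icc 0 T, f t = g t := by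
  rw [← closure_Ioc hT.ne]
  exact Set.EqOn.closure (fun t ht => h t ht) hf hg

set_option maxHeartbeats 2000000 in
/-- First-order convergence of the scheme in the maximum norm. -/
lemma exists_scheme_error_bound
    (a T : ℝ) (ha : 0 < a) (hT : 0 < T)
    (d B : ℝ → ℝ → ℝ) (ψ1 ψ2 u0 : ℝ → ℝ) (u : ℝ → ℝ → ℝ)
    (hd_smooth : ContDiff ℝ (⊤ : ℕ∞) (Function.uncurry d))
    (hB_smooth : ContDiff ℝ (⊤ : ℕ∞) (Function.uncurry B))
    (hψ1 : ContDiff ℝ (⊤ : ℕ∞) ψ1) (hψ2 : ContDiff ℝ (⊤ : ℕ∞) ψ2)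
    (L : ℝ) (hL : 0 < L)
    (hdLip : ∀ x s s' : ℝ, |d x s - d x s'| ≤ L * |s - s'|)
    (hBLip : ∀ x s s' : ℝ, |B x s - B x s'| ≤ L * |s - s'|)
    (hu : ContDiff ℝ 3 (Function.uncurry u))
    (hu_bdd : ∀ m : ℕ, m ≤ 3 → ∃ K : ℝ, ∀ p : ℝ × ℝ,
      ‖iteratedFDeriv ℝ m (Function.uncurry u) p‖ ≤ K)
    (hPDE : ∀ x ∈ Set.Ioo 0 a, ∀ t ∈ Set.Ioc 0 T,
      deriv (fun τ => u x τ) t + deriv (fun ξ => u ξ t) x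
          + d x (∫ x in (0:ℝ)..a, ψ1 x * u x t) * u x t
        = deriv (deriv (fun ξ => u ξ t)) x)
    (hRobin : ∀ t ∈ Set.Icc (0:ℝ) T,
      u 0 t - deriv (fun ξ => u ξ t) 0
        = ∫ x in (0:ℝ)..a, B x (∫ x in (0:ℝ)..a, ψ2 x * u x t) * u x t)
    (hinit : ∀ x ∈ Set.Ioo (0:ℝ) a, u x 0 = u0 x)
    (hDir : ∀ t ∈ Set.Icc (0:ℝ) T, u a t = 0) :
    ∃ C h₁ : ℝ, 0 ≤ C ∧ 0 < h₁ ∧ ∀ (M' N : ℕ) (h k r lam : ℝ), 0 < M' → 0 < h → 0 < k →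
      0 < r → 0 < lam → 2*((M':ℝ)+3)*h = a → (N:ℝ) * k = T → k = r * h^2 → k = lam * h →
      lam + 2*r ≤ 1 → h ≤ h₁ → ∀ (U0 : ℕ → ℝ) (U : ℕ → ℕ → ℝ) (UM : ℕ → ℝ),
      (∀ n, phiP0 h M' B ψ2 U0 U n = 0) → (∀ n, phiPM h UM n = 0) →
      (∀ n i, phiP h k M' d ψ1 u0 U0 U UM n i = 0) →
      ∀ n ≤ N, ∀ i ≤ 2*(M'+3),
        |u ((i:ℝ)*h) ((n:ℝ)*k) - extV (2*(M'+3)) U0 U UM n i| ≤ C * h := by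
  obtain ⟨K, ux, uxx, uxxx, ut, utt, hK, hKx, hKxx, hKxxx, hKtt, hcx, hcxx, hct, h1, h2, h3, k1, k2⟩
    := exists_partial_derivatives hu hu_bdd
  have hK0 : 0 ≤ K := (abs_nonneg _).trans (hK 0 0)
  have hcu : Continuous (Function.uncurry u) := hu.continuous
  have hv : ∀ t, BddLipOn a K fun x => u x t := fun t x _ => ⟨hK x t, fun y _ =>
    abs_sub_le_of_hasDerivAt (fun s _ => h1 s t) fun s _ => hKx (s, t)⟩
  have hdx : ∀ t, (deriv fun ξ => u ξ t) = fun x => ux (x, t) :=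
    fun t => funext fun x => (h1 x t).deriv
  have hPDE' : ∀ x ∈ Set.Ioo 0 a, ∀ t ∈ Set.Icc 0 T,
      ut (x, t) + ux (x, t) + d x (∫ x in (0:ℝ)..a, ψ1 x * u x t) * u x t = uxx (x, t) := by
    intro x hx
    have hs : Continuous fun t => ∫ x in (0:ℝ)..a, ψ1 x * u x t :=
      intervalIntegral.continuous_parametric_intervalIntegral_of_continuous'
        (f := fun t x => ψ1 x * u x t)
        ((hψ1.continuous.comp continuous_snd).mul (hcu.comp (continuous_snd.prodMk continuous_fst)))
        0 a
    have hp : Continuous fun t : ℝ => (x, t) := continuous_const.prodMk continuous_id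
    refine eqOn_Icc_of_eqOn_Ioc (((hct.comp hp).add (hcx.comp hp)).add
      ((hd_smooth.continuous.comp (continuous_const.prodMk hs)).mul (hcu.comp hp)))
      (hcxx.comp hp) hT fun t ht => ?_
    have := hPDE x hx t ht
    rw [hdx, (k1 x t).deriv, (h2 x t).deriv] at this
    exact this
  have hRobin' : ∀ t ∈ Set.Icc (0:ℝ) T, u 0 t - ux (0, t)
      = ∫ x in (0:ℝ)..a, B x (∫ x in (0:ℝ)..a, ψ2 x * u x t) * u x t := by
    intro t ht
    have := hRobin t ht
    rwa [hdx] at this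
  obtain ⟨K₁, hK₁, hψ1K⟩ := exists_bddLipOn hψ1 a
  obtain ⟨K₂, hK₂, hψ2K⟩ := exists_bddLipOn hψ2 a
  obtain ⟨Kd, hKd, hdK⟩ := exists_bound_and_lipschitz hd_smooth a (3 * a * K₁ * K)
  obtain ⟨KB, hKB, hBK⟩ := exists_bound_and_lipschitz hB_smooth a (3 * a * K₂ * K)
  obtain ⟨C₂, hC₂⟩ : ∃ C₂, C₂ = Kd + 3 * a * L * K₁ * (K + 1) := ⟨_, rfl⟩
  obtain ⟨C₃, hC₃⟩ : ∃ C₃, C₃ = 3 * a * (KB + 3 * a * L * K₂ * (K + 1)) := ⟨_, rfl⟩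
  obtain ⟨E₁, hE₁⟩ : ∃ E₁, E₁ = K + 16 * a * KB * K + 3 * a * (L * (16 * a * K₂ * K) * K) :=
    ⟨_, rfl⟩
  obtain ⟨E₂, hE₂⟩ : ∃ E₂, E₂ = 4 * K + L * (16 * a * K₁ * K) * K := ⟨_, rfl⟩
  have hC₂0 : 0 ≤ C₂ := by rw [hC₂]; positivity
  have hC₃0 : 0 ≤ C₃ := by rw [hC₃]; positivity
  have hE₁0 : 0 ≤ E₁ := by rw [hE₁]; positivity
  have hE₂0 : 0 ≤ E₂ := by rw [hE₂]; positivity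
  obtain ⟨c, hc⟩ : ∃ c, c = 2 * C₃ + 2 := ⟨_, rfl⟩
  obtain ⟨D, hD⟩ : ∃ D, D = c + c^2 + Real.exp (c*a) * (C₂ + 1) := ⟨_, rfl⟩
  have hc0 : 0 < c := by linarith
  obtain ⟨C, hC⟩ : ∃ C, C = (E₁ + E₂) * Real.exp (D*T) := ⟨_, rfl⟩
  have hC0 : 0 ≤ C := by rw [hC]; positivity
  refine ⟨C, min (1/c) (1/(C+1)), hC0, by positivity, ?_⟩
  intro M' N h k r lam hM' hh hk hr hlam hMh hNk hkr hkl hstab hh₁ U0 U UM hP0 hPM hP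
  have hch : c * h ≤ 1 := by
    have := hh₁.trans (min_le_left _ _)
    rw [le_div_iff₀ hc0] at this
    linarith
  have hCh : C * h ≤ 1 := by
    have := hh₁.trans (min_le_right _ _)
    rw [le_div_iff₀ (by positivity)] at this
    linarith
  have hkh : k ≤ h := by
    rw [hkl]
    exact mul_le_of_le_one_left hh.le (by linarith)
  have hMh' : ((2*(M'+3) : ℕ) : ℝ) * h = a := by push_cast; exact hMh
  have htime : ∀ n ≤ N, (n:ℝ)*k ∈ Set.Icc 0 T := fun n hn => by
    refine ⟨by positivity, ?_⟩
    rw [← hNk]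
    gcongr
  have hUM : ∀ n, UM n = 0 := fun n => by simpa [phiPM, hh.ne'] using hPM n
  obtain ⟨e, he⟩ : ∃ e : ℕ → ℕ → ℝ, e = fun (n i : ℕ) =>
    u ((i:ℝ)*h) ((n:ℝ)*k) - extV (2*(M'+3)) U0 U UM n i := ⟨_, rfl⟩
  have hext0 : ∀ n, extV (2*(M'+3)) U0 U UM n 0 = U0 n := fun n => if_pos rfl
  have hexti : ∀ n i, 1 ≤ i → i < 2*(M'+3) → extV (2*(M'+3)) U0 U UM n i = U n i :=
    fun n i hi hi' => by rw [extV, if_neg (by lia), if_neg (by lia)]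
  have hei : ∀ n i, 1 ≤ i → i < 2*(M'+3) → e n i = u ((i:ℝ)*h) ((n:ℝ)*k) - U n i :=
    fun n i hi hi' => by rw [he, ← hexti n i hi hi']
  have nonlocal : ∀ (g : ℝ → ℝ) (ψ : ℝ → ℝ) (Kψ Kg : ℝ), 0 ≤ Kψ → BddLipOn a Kψ ψ →
      (∀ s s', |g s - g s'| ≤ L * |s - s'|) → (∀ s, |s| ≤ 3 * a * Kψ * K → |g s| ≤ Kg) →
      ∀ n, ∀ S ≤ 1, (∀ i, 1 ≤ i → i < 2*(M'+3) → |e n i| ≤ S) →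
      ∀ i, 1 ≤ i → i < 2*(M'+3) →
      |g (Qh h M' fun j => ψ ((j:ℝ)*h) * u ((j:ℝ)*h) ((n:ℝ)*k)) * u ((i:ℝ)*h) ((n:ℝ)*k)
        - g (Qh h M' fun j => ψ ((j:ℝ)*h) * U n j) * U n i|
        ≤ (Kg + 3 * a * L * Kψ * (K + 1)) * S := by
    intro g ψ Kψ Kg hKψ hψ hgL hgK n S hS heS i hi hi'
    refine abs_nonlocal_mul_sub_le hL.le hgL hh.le hMh (ψ := fun j => ψ ((j:ℝ)*h))
      (V := fun j => u ((j:ℝ)*h) ((n:ℝ)*k)) hKψ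
      (fun j _ hj => (hψ _ (mesh_mem_Icc hh.le hMh (by lia))).1)
      (hgK _ (abs_Qh_mul_le hh.le hMh hKψ hK0 hψ (hv _)))
      ((abs_nonneg _).trans (heS i hi hi')) (fun j hj hj' => ?_) hi (by lia) ?_
    · rw [← hei n j hj (by lia)]
      exact heS j hj (by lia)
    · have := heS i hi hi'
      rw [hei n i hi hi', abs_le] at this
      have := abs_le.1 (hK ((i:ℝ)*h) ((n:ℝ)*k))
      rw [abs_le]
      constructor <;> linarith
  have key := abs_error_le (a := a) (T := T) (h := h) (k := k) (r := r) (lam := lam) (C₂ := C₂)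
    (C₃ := C₃) (η := (E₁ + E₂) * h) (M := 2*(M'+3)) (N := N) (by lia) hMh' hNk hh hk hr hlam hkr hkl
    hstab hC₂0 hC₃0 (by positivity) hc hch hD
    (by rwa [mul_right_comm, ← hC]) e
    (fun n i => (e (n+1) i - ((1 - lam - 2*r) * e n i + (lam + r) * e n (i-1) + r * e n (i+1))) / k)
    (fun n => (1 + 1/h) * e n 0 - e n 1 / h) (fun n _ => by ring)
    (fun n _ i _ _ => by rw [mul_div_cancel₀ _ hk.ne']; ring) ?_ ?_ ?_ ?_
  · intro n hn i hi
    have := key n hn i hi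
    rwa [mul_right_comm, ← hC, he] at this
  · intro n hn S hS heS
    have hS0 : 0 ≤ S := (abs_nonneg _).trans (heS 1 le_rfl (by lia))
    have hcons := abs_boundary_consistency_le (b := B) hh hM' hMh hL.le hK0 hK₂ hKB
      (fun s => h1 s ((n:ℝ)*k)) (fun s => h2 s _) (fun s => hKxx _) hψ2.continuous hψ2K
      (hv _) (fun s => hB_smooth.continuous.comp (continuous_id.prodMk continuous_const))
      hBK hBLip (hRobin' _ (htime n hn))
    rw [← hE₁] at hcons
    have hQ := abs_Qh_le (S := (KB + 3 * a * L * K₂ * (K + 1)) * S) hh.le (by positivity)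
      (M' := M') (V := fun i => B ((i:ℝ)*h) (Qh h M' fun j => ψ2 ((j:ℝ)*h) * u ((j:ℝ)*h) ((n:ℝ)*k))
          * u ((i:ℝ)*h) ((n:ℝ)*k)
        - B ((i:ℝ)*h) (Qh h M' fun j => ψ2 ((j:ℝ)*h) * U n j) * U n i)
      (fun i hi hi' => nonlocal (B ((i:ℝ)*h)) ψ2 K₂ KB hK₂ hψ2K (hBLip _)
        (fun s hs => (hBK s hs _ (mesh_mem_Icc hh.le hMh (by lia))).1) n S hS heS i hi (by lia))
    rw [← Qh_sub, hMh, ← mul_assoc, ← hC₃] at hQ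
    have h0 := hP0 n
    rw [phiP0] at h0
    have e1 := hei n 1 le_rfl (by lia)
    have e0 : e n 0 = u 0 ((n:ℝ)*k) - U0 n := by rw [he, ← hext0]; simp
    rw [Nat.cast_one, one_mul] at e1
    have heq : (1 + 1/h) * e n 0 - e n 1 / h
        = ((1 + 1/h) * u 0 ((n:ℝ)*k) - (1/h) * u h ((n:ℝ)*k))
          - ((1 + 1/h) * U0 n - (1/h) * U n 1) := by
      rw [e0, e1]
      ring
    have hE := mul_nonneg hE₂0 hh.le
    rw [heq]
    rw [abs_le] at hcons hQ ⊢
    constructor <;> linarith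
  · intro n hn S hS heS i hi hi'
    have hx : (i:ℝ)*h ∈ Set.Ioo 0 a := by
      have : (0:ℝ) < i := by exact_mod_cast hi
      refine ⟨by positivity, ?_⟩
      rw [← hMh']
      gcongr
    have hcons := abs_interior_consistency_le (g := d ((i:ℝ)*h)) hh hk hkh hM' hMh hL.le hK0 hK₁
      (fun s => h1 s ((n:ℝ)*k)) (fun s => h2 s _) (fun s => h3 s _) (fun s => hKxx _)
      (fun s => hKxxx _) (fun s => k1 ((i:ℝ)*h) s) (fun s => k2 _ s) (fun s => hKtt _) rfl (hK _ _)
      hψ1.continuous hψ1K (hv _) (hdLip _) (hPDE' _ hx _ (htime n hn.le))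
    rw [← hE₂] at hcons
    have hnl := nonlocal (d ((i:ℝ)*h)) ψ1 K₁ Kd hK₁ hψ1K (hdLip _)
      (fun s hs => (hdK s hs _ (mesh_mem_Icc hh.le hMh hi'.le)).1) n S hS heS i hi hi'
    rw [← hC₂] at hnl
    have hPi := hP (n+1) i
    rw [phiP, if_neg (Nat.succ_ne_zero n), phiPi, Nat.add_sub_cancel] at hPi
    obtain ⟨j, rfl⟩ : ∃ j, i = j + 1 := ⟨i - 1, by lia⟩
    have e0 := hei n _ hi hi'
    have e1 := hei (n+1) _ hi hi'
    have em : e n j = u (((j+1:ℕ):ℝ)*h - h) ((n:ℝ)*k) - extV (2*(M'+3)) U0 U UM n j := by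
      rw [he]
      push_cast
      ring_nf
    have ep : e n (j+1+1) = u (((j+1:ℕ):ℝ)*h + h) ((n:ℝ)*k)
        - extV (2*(M'+3)) U0 U UM n (j+1+1) := by
      rw [he]
      push_cast
      ring_nf
    rw [hexti n _ hi hi'] at hPi
    rw [Nat.add_sub_cancel] at hPi ⊢
    rw [show ((n+1:ℕ):ℝ)*k = (n:ℝ)*k + k by push_cast; ring] at e1
    have hlk : lam / k = 1 / h := by rw [hkl]; field_simp
    have hrk : r / k = 1 / h^2 := by rw [hkr]; field_simp
    have heq : (e (n+1) (j+1) - ((1 - lam - 2*r) * e n (j+1) + (lam + r) * e n j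
          + r * e n (j+1+1))) / k
        = (e (n+1) (j+1) - e n (j+1)) / k + (e n (j+1) - e n j) / h
          - (e n (j+1+1) + e n j - 2 * e n (j+1)) / h^2 := by
      linear_combination (e n (j+1) - e n j) * hlk
        - (e n (j+1+1) + e n j - 2 * e n (j+1)) * hrk
    have hE := mul_nonneg hE₁0 hh.le
    rw [heq, e0, e1, em, ep]
    rw [abs_le] at hcons hnl ⊢
    constructor <;> ring_nf at hcons hnl hPi hE ⊢ <;> linarith
  · intro n hn
    have : extV (2*(M'+3)) U0 U UM n (2*(M'+3)) = 0 := by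
      rw [extV, if_neg (by lia), if_pos rfl, hUM]
    rw [he]
    dsimp only
    rw [this, hMh', hDir _ (htime n hn), sub_zero]
  · intro i hi hi'
    have hx : (i:ℝ)*h ∈ Set.Ioo 0 a := by
      have : (0:ℝ) < i := by exact_mod_cast hi
      refine ⟨by positivity, ?_⟩
      rw [← hMh']
      gcongr
    have := hP 0 i
    rw [phiP, if_pos rfl] at this
    rw [hei 0 i hi hi', Nat.cast_zero, zero_mul, hinit _ hx]
    linarith

/-- **Convergence.** Under the consistency hypotheses, the mesh coupling
`k = r h² = λ h` with `λ + 2r ≤ 1`, and `‖U⁰ - u⁰‖ = O(h)`, the discretization is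
convergent: for all `h ≤ h₀` the discrete equations `Φ_h(U_h) = 0` have a solution `U_h`,
and `‖u_h - U_h‖_{X_h} → 0` as `h → 0`. -/
theorem stmt_3
    (adag T : ℝ) (hadag : 0 < adag) (hT : 0 < T)
    (d B : ℝ → ℝ → ℝ) (ψ1 ψ2 u0 : ℝ → ℝ) (u : ℝ → ℝ → ℝ) (s1 s2 : ℝ → ℝ)
    (hs1 : ∀ t : ℝ, s1 t = ∫ x in (0:ℝ)..adag, ψ1 x * u x t)
    (hs2 : ∀ t : ℝ, s2 t = ∫ x in (0:ℝ)..adag, ψ2 x * u x t)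
    (hd0 : ∀ x s : ℝ, 0 ≤ d x s) (hB0 : ∀ x s : ℝ, 0 ≤ B x s)
    (hd_smooth : ContDiff ℝ (⊤ : ℕ∞) (Function.uncurry d))
    (hB_smooth : ContDiff ℝ (⊤ : ℕ∞) (Function.uncurry B))
    (hψ1 : ContDiff ℝ (⊤ : ℕ∞) ψ1) (hψ2 : ContDiff ℝ (⊤ : ℕ∞) ψ2) (hu0 : ContDiff ℝ (⊤ : ℕ∞) u0)
    (L : ℝ) (hL : 0 < L)
    (hdLip : ∀ x s s' : ℝ, |d x s - d x s'| ≤ L * |s - s'|)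
    (hBLip : ∀ x s s' : ℝ, |B x s - B x s'| ≤ L * |s - s'|)
    (hu : ContDiff ℝ 3 (Function.uncurry u))
    (hu_bdd : ∀ m : ℕ, m ≤ 3 → ∃ K : ℝ, ∀ p : ℝ × ℝ,
      ‖iteratedFDeriv ℝ m (Function.uncurry u) p‖ ≤ K)
    (hPDE : ∀ x ∈ Set.Ioo 0 adag, ∀ t ∈ Set.Ioc 0 T,
      deriv (fun τ => u x τ) t + deriv (fun ξ => u ξ t) x + d x (s1 t) * u x t
        = deriv (deriv (fun ξ => u ξ t)) x)
    (hRobin : ∀ t ∈ Set.Icc (0:ℝ) T,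
      u 0 t - deriv (fun ξ => u ξ t) 0 = ∫ x in (0:ℝ)..adag, B x (s2 t) * u x t)
    (hinit : ∀ x ∈ Set.Ioo (0:ℝ) adag, u x 0 = u0 x)
    (hDir : ∀ t ∈ Set.Icc (0:ℝ) T, u adag t = 0)
    (hO : ∃ C1 > 0, ∀ M' : ℕ, 0 < M' →
      Real.sqrt (normSq (adag / (2*(M'+3) : ℝ)) (2*(M'+3))
          (fun i => u0 ((i:ℝ) * (adag / (2*(M'+3) : ℝ)))
            - u ((i:ℝ) * (adag / (2*(M'+3) : ℝ))) 0))
        ≤ C1 * (adag / (2*(M'+3) : ℝ))) :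
    ∃ h₀ > 0, ∀ ε > 0, ∃ h₁ > 0, ∀ M' N : ℕ, 0 < M' → 0 < N →
      ∀ r lam : ℝ, 0 < r → 0 < lam →
      let M := 2*(M'+3); let h := adag / (M : ℝ); let k := T / (N : ℝ);
      k = r * h^2 → k = lam * h → lam + 2*r ≤ 1 → h ≤ h₀ →
      ∃ (U0 : ℕ → ℝ) (U : ℕ → ℕ → ℝ) (UM : ℕ → ℝ),
        Solves adag T d B ψ1 ψ2 u0 M' N U0 U UM ∧
        (h ≤ h₁ →
          XNorm h k M N (fun n => u 0 ((n:ℝ)*k) - U0 n)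
              (fun n i => u ((i:ℝ)*h) ((n:ℝ)*k) - U n i)
              (fun n => u adag ((n:ℝ)*k) - UM n) ≤ ε) := by
  obtain ⟨C, h₁, hC, hh₁, hbound⟩ := exists_scheme_error_bound adag T hadag hT d B ψ1 ψ2 u0 u
    hd_smooth hB_smooth hψ1 hψ2 L hL hdLip hBLip hu hu_bdd
    (by simpa only [hs1] using hPDE) (by simpa only [hs2] using hRobin) hinit hDir
  obtain ⟨G, hG⟩ : ∃ G, G = (2 * Real.sqrt (2*T) + Real.sqrt adag) * C := ⟨_, rfl⟩
  have hG0 : 0 ≤ G := by rw [hG]; positivity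
  refine ⟨1, one_pos, fun ε hε => ⟨min h₁ (ε/(G+1)), by positivity, ?_⟩⟩
  intro M' N hM' hN r lam hr hlam M h k hkr hkl hstab hh1
  have hh : 0 < h := div_pos hadag (by simp only [M]; positivity)
  have hk : 0 < k := div_pos hT (by exact_mod_cast hN)
  have hMh : (M:ℝ) * h = adag := mul_div_cancel₀ _ (by simp only [M]; positivity)
  have hMh' : 2*((M':ℝ)+3)*h = adag := by
    rw [← hMh]
    simp only [M]
    push_cast
    ring
  have hNk : (N:ℝ) * k = T := mul_div_cancel₀ _ (by exact_mod_cast hN.ne')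
  obtain ⟨U0, U, UM, hP0, hPM, hP⟩ := exists_scheme_solution h k hh hk M' d B ψ1 ψ2 u0
  refine ⟨U0, U, UM, ⟨fun n _ => hP0 n, fun n _ => hPM n, fun n _ i _ _ => hP n i⟩, fun hle => ?_⟩
  have herr := hbound M' N h k r lam hM' hh hk hr hlam hMh' hNk hkr hkl hstab
    (hle.trans (min_le_left _ _)) U0 U UM hP0 hPM hP
  have hX := XNorm_le (T := T) (a := adag) (E := C * h) (M := M) (N := N) (h := h) (k := k)
    hh.le hk.le hNk hN hMh (by positivity)
    (V0 := fun n => u 0 ((n:ℝ)*k) - U0 n) (V := fun n i => u ((i:ℝ)*h) ((n:ℝ)*k) - U n i)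
    (VM := fun n => u adag ((n:ℝ)*k) - UM n)
    (fun n hn => by simpa [extV] using herr n hn 0 (Nat.zero_le _))
    (fun n hn i hi hi' => by
      have := herr n hn i (by lia)
      rwa [extV, if_neg (by lia), if_neg (by lia)] at this)
    (fun n hn => by
      have := herr n hn M le_rfl
      rwa [hMh, extV, if_neg (by lia), if_pos rfl] at this)
  calc _ ≤ (2 * h * Real.sqrt (2*T) + Real.sqrt adag) * (C * h) := hX
    _ ≤ (2 * 1 * Real.sqrt (2*T) + Real.sqrt adag) * (C * h) := by gcongr
    _ = G * h := by rw [hG]; ring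
    _ ≤ (G + 1) * (ε/(G+1)) := by
        gcongr
        · linarith
        · exact hle.trans (min_le_right _ _)
    _ = ε := mul_div_cancel₀ _ (by positivity)
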